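/- Let k be a number field with ring of integers 𝒪, let m ≥ 2 be an integer, and let R be the subring of k consisting of all elements that are v-integral for every finite place v of k dividing m. Let n ≥ 2. Then every subgroup H of finite index in SL_n(R) is a congruence subgroup: there exists a nonzero ideal 𝔞 of R such that every matrix A ∈ SL_n(R) congruent to the identity modulo 𝔞 (i.e. with every entry of A − I in 𝔞) belongs to H. -/

import Mathlib

/-- The ring `R` of the paper (§7.1): the subring of a number field `k`
consisting of the elements that are `v`-integral at every finite place `v`
dividing `m`. -/
noncomputable def paperSRing (k : Type*) [Field k] [NumberField k] (m : ℕ) : Subring k :=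
  ⨅ v ∈ {v : IsDedekindDomain.HeightOneSpectrum (NumberField.RingOfIntegers k) |
      (m : NumberField.RingOfIntegers k) ∈ v.asIdeal},
    (IsDedekindDomain.HeightOneSpectrum.valuation (K := k) v).integer

namespace CongAux
open Matrix
variable {ι R : Type*} [Fintype ι] [DecidableEq ι] [CommRing R]

theorem col_mul (c : ι → R) (k : ι) (M : Matrix ι ι R) (i j : ι) :
    ((1 + vecMulVec c (Pi.single k 1)) * M) i j = M i j + c i * M k j := by
  rw [add_mul, one_mul, Matrix.add_apply, vecMulVec_mul, single_one_vecMul, vecMulVec_apply]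
  rfl

theorem mul_row (d : ι → R) (k : ι) (M : Matrix ι ι R) (i j : ι) :
    (M * (1 + vecMulVec (Pi.single k 1) d)) i j = M i j + M i k * d j := by
  rw [mul_add, mul_one, Matrix.add_apply, mul_vecMulVec, mulVec_single_one, vecMulVec_apply]
  rfl

theorem col_mem (S : Submonoid (Matrix ι ι R)) (a : Ideal R)
    (h1 : ∀ i j, i ≠ j → ∀ x ∈ a, transvection i j x ∈ S)
    (k : ι) (c : ι → R) (hc : ∀ i, c i ∈ a) (s : Finset ι) (hs : k ∉ s) :
    1 + vecMulVec (fun i => if i ∈ s then c i else 0) (Pi.single k 1) ∈ S := by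
  induction s using Finset.induction_on with
  | empty =>
    have : vecMulVec (fun _ : ι => (0 : R)) (Pi.single k 1) = 0 := by
      ext i j; simp [vecMulVec_apply]
    simp [this, one_mem]
  | insert b t hb ih =>
    have hkb : b ≠ k := by rintro rfl; simp at hs
    have hkt : k ∉ t := fun h => hs (by simp [h])
    have := S.mul_mem (ih hkt) (h1 b k hkb (c b) (hc b))
    convert this using 1
    ext i j
    rw [col_mul]
    simp only [transvection, Matrix.add_apply, vecMulVec_apply, single_apply, one_apply, Pi.single_apply]
    by_cases hib : i = b
    · subst hib
      by_cases hj : j = k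
      · subst hj; simp [hb, hkb]
      · simp [hb, hj, Ne.symm hj]
    · by_cases hj : j = k
      · subst hj; simp [hib, hkb, Ne.symm hib]
      · simp [hj, Ne.symm hj]

theorem row_mem (S : Submonoid (Matrix ι ι R)) (a : Ideal R)
    (h1 : ∀ i j, i ≠ j → ∀ x ∈ a, transvection i j x ∈ S)
    (k : ι) (c : ι → R) (hc : ∀ i, c i ∈ a) (s : Finset ι) (hs : k ∉ s) :
    1 + vecMulVec (Pi.single k 1) (fun i => if i ∈ s then c i else 0) ∈ S := by
  induction s using Finset.induction_on with
  | empty =>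
    have : vecMulVec (Pi.single k 1) (fun _ : ι => (0 : R)) = 0 := by
      ext i j; simp [vecMulVec_apply]
    simp [this, one_mem]
  | insert b t hb ih =>
    have hkb : b ≠ k := by rintro rfl; simp at hs
    have hkt : k ∉ t := fun h => hs (by simp [h])
    have := S.mul_mem (h1 k b hkb.symm (c b) (hc b)) (ih hkt)
    convert this using 1
    ext i j
    rw [mul_row]
    simp only [transvection, Matrix.add_apply, vecMulVec_apply, single_apply, one_apply, Pi.single_apply]
    by_cases hib : j = b
    · subst hib
      by_cases hj : i = k
      · subst hj; simp [hb, hkb]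
      · simp [hb, hj, Ne.symm hj]
    · by_cases hj : i = k
      · subst hj; simp [hib, hkb, Ne.symm hib]
      · simp [hj, Ne.symm hj]

theorem diag_mem (S : Submonoid (Matrix ι ι R)) (a : Ideal R)
    (h1 : ∀ i j, i ≠ j → ∀ x ∈ a, transvection i j x ∈ S)
    (h2 : ∀ i j, i ≠ j → ∀ x ∈ a,
      transvection i j 1 * transvection j i x * transvection i j (-1) ∈ S)
    (k l : ι) (hkl : k ≠ l) (t w : R) (ht : t ∈ a) (hw : (1 + t) * w = 1) :
    diagonal (fun i => if i = k then 1 + t else if i = l then w else 1) ∈ S := by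
  have := S.mul_mem (S.mul_mem (h1 l k hkl.symm (-t * w) (a.mul_mem_right _ (a.neg_mem ht)))
    (h2 k l hkl t ht)) (h1 k l hkl (t * w) (a.mul_mem_right _ ht))
  convert this using 1
  have e1 : diagonal (fun i => if i = k then 1 + t else if i = l then w else 1)
      = 1 + single k k t + single l l (w - 1) := by
    ext i j
    simp only [diagonal_apply, Matrix.add_apply, one_apply, single_apply]
    by_cases hij : i = j
    · subst hij
      by_cases hk : i = k
      · subst hk; simp [hkl, hkl.symm]
      · by_cases hl : i = l
        · subst hl; simp [hkl, hk]
        · simp [hk, hl, Ne.symm hk, Ne.symm hl]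
    · have : ∀ b : ι, ¬ (b = i ∧ b = j) := by rintro b ⟨rfl, rfl⟩; exact hij rfl
      simp [hij, this]
  rw [e1]
  simp only [transvection, mul_add, add_mul, mul_one, one_mul, single_mul_single_same,
    single_mul_single_of_ne _ _ _ _ hkl, single_mul_single_of_ne _ _ _ _ hkl.symm, add_zero, zero_add]
  have hw' : t * w = 1 - w := by linear_combination hw
  ext i j
  simp only [Matrix.add_apply, single_apply]
  have q1 : -t * w = w - 1 := by linear_combination -hw'
  rw [hw', q1]
  have hlk := hkl.symm
  rcases Classical.propComplete (k = i) with a1 | a1 <;>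
  rcases Classical.propComplete (l = i) with a2 | a2 <;>
  rcases Classical.propComplete (k = j) with a3 | a3 <;>
  rcases Classical.propComplete (l = j) with a4 | a4 <;>
    first
    | (exfalso; exact hkl ((of_eq_true a1).trans (of_eq_true a2).symm))
    | (exfalso; exact hkl ((of_eq_true a3).trans (of_eq_true a4).symm))
    | (simp only [a1, a2, a3, a4, and_true, true_and, and_false, false_and, and_self, if_true, if_false]
       first
       | ring1
       | linear_combination hw
       | linear_combination -hw
       | linear_combination t * hw
       | linear_combination -t * hw
       | linear_combination w * hw
       | linear_combination (1 - t) * hw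
       | linear_combination (t - 1) * hw
       | skip)

theorem main (S : Submonoid (Matrix ι ι R)) (a : Ideal R)
    (h1 : ∀ i j, i ≠ j → ∀ x ∈ a, transvection i j x ∈ S)
    (h2 : ∀ i j, i ≠ j → ∀ x ∈ a,
      transvection i j 1 * transvection j i x * transvection i j (-1) ∈ S)
    (hdet : ∀ M ∈ S, M.det = 1)
    (hu : ∀ x ∈ a, ∃ w, (1 + x) * w = 1) (s : Finset ι) :
    ∀ A : Matrix ι ι R, A.det = 1 → (∀ i j, (A - 1) i j ∈ a) →
      (∀ i j, (i ∉ s ∨ j ∉ s) → A i j = (1 : Matrix ι ι R) i j) → A ∈ S := by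
  induction s using Finset.induction_on with
  | empty =>
    intro A _ _ h
    have : A = 1 := by ext i j; exact h i j (by simp)
    rw [this]; exact one_mem S
  | insert k t hk ih =>
    intro A hA ha hsup
    -- the case where the pivot is one
    have key : ∀ A : Matrix ι ι R, A.det = 1 → (∀ i j, (A - 1) i j ∈ a) →
        (∀ i j, (i ∉ insert k t ∨ j ∉ insert k t) → A i j = (1 : Matrix ι ι R) i j) →
        A k k = 1 → A ∈ S := by
      intro A hA ha hsup hkk
      have hoff : ∀ i j, i ≠ j → A i j ∈ a := by
        intro i j hij
        have := ha i j
        simpa [hij] using this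
      have hL := col_mem S a h1 k (fun i => if i = k then 0 else A i k)
        (by intro i; by_cases h : i = k
            · simp [h]
            · simp [h, hoff i k h]) (Finset.univ.erase k) (by simp)
      have hU := row_mem S a h1 k (fun i => if i = k then 0 else A k i)
        (by intro i; by_cases h : i = k
            · simp [h]
            · simp [h, hoff k i (Ne.symm h)]) (Finset.univ.erase k) (by simp)
      let B : Matrix ι ι R := Matrix.of fun i j =>
        if i = k ∨ j = k then (1 : Matrix ι ι R) i j else A i j - A i k * A k j
      have hB : ∀ i j, B i j =
        if i = k ∨ j = k then (1 : Matrix ι ι R) i j else A i j - A i k * A k j := fun _ _ => rfl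
      set L := 1 + vecMulVec (fun i => if i ∈ Finset.univ.erase k then
        (if i = k then 0 else A i k) else 0) (Pi.single k 1) with hLdef
      set U := 1 + vecMulVec (Pi.single k 1) (fun i => if i ∈ Finset.univ.erase k then
        (if i = k then 0 else A k i) else 0) with hUdef
      have hfac : A = L * B * U := by
        ext i j
        rw [hUdef, mul_row, hLdef, col_mul, col_mul, hB, hB, hB, hB]
        by_cases hi : i = k
        · subst hi
          by_cases hj : j = i
          · subst hj; simp [hkk]
          · simp [hj, Ne.symm hj]
        · by_cases hj : j = k
          · subst hj; simp [hi]
          · simp [hi, hj, Ne.symm hj]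
      have hBdet : B.det = 1 := by
        have := hA
        rw [hfac, det_mul, det_mul, hdet _ hL, hdet _ hU] at this
        simpa using this
      have hBS : B ∈ S := by
        apply ih B hBdet
        · intro i j
          rw [Matrix.sub_apply, hB]
          split_ifs with h
          · simp
          · push Not at h
            have := a.sub_mem (ha i j) (a.mul_mem_right (A k j) (hoff i k h.1))
            rw [Matrix.sub_apply] at this
            convert this using 1
            ring
        · intro i j hij
          rw [hB]
          split_ifs with h
          · rfl
          · push Not at h
            rcases hij with hi | hj
            · rw [hsup i j (Or.inl (by simp [h.1, hi])), hsup i k (Or.inl (by simp [h.1, hi]))]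
              simp [h.1]
            · rw [hsup i j (Or.inr (by simp [h.2, hj])), hsup k j (Or.inr (by simp [h.2, hj]))]
              simp [Ne.symm h.2]
      rw [hfac]
      exact S.mul_mem (S.mul_mem hL hBS) hU
    rcases t.eq_empty_or_nonempty with rfl | ⟨l, hl⟩
    · apply key A hA ha hsup
      have hd : A = diagonal (Function.update 1 k (A k k)) := by
        ext i j
        by_cases h : i = k ∧ j = k
        · obtain ⟨rfl, rfl⟩ := h; simp
        · rw [hsup i j (by simp; tauto)]
          by_cases hij : i = j
          · subst hij
            have : i ≠ k := by tauto
            simp [this]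
          · simp [hij]
      have := hA
      rw [hd, det_diagonal, Finset.prod_update_of_mem (Finset.mem_univ k)] at this
      simpa using this
    · have hkl : k ≠ l := by rintro rfl; exact hk hl
      obtain ⟨w, hw⟩ := hu _ (ha k k)
      have hw' : A k k * w = 1 := by simpa using hw
      have hwa : w - 1 ∈ a := by
        have := a.mul_mem_right (-w) (ha k k)
        convert this using 1
        simp; linear_combination hw'
      have hD := diag_mem S a h1 h2 k l hkl _ w (ha k k) hw
      obtain ⟨w2, hw2⟩ := hu _ hwa
      have hD' := diag_mem S a h1 h2 k l hkl (w - 1) (A k k) hwa (by linear_combination hw')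
      set D := diagonal (fun i => if i = k then 1 + (A - 1) k k else if i = l then w else 1) with hDd
      set D' := diagonal (fun i => if i = k then 1 + (w - 1) else if i = l then A k k else 1) with hDd'
      have hDD : D * D' = 1 := by
        rw [hDd, hDd', diagonal_mul_diagonal, ← diagonal_one]
        congr 1
        ext i
        by_cases h : i = k
        · simp [h, hw']
        · by_cases h' : i = l
          · simp [h', hkl.symm]; linear_combination hw'
          · simp [h, h']
      have hfac : A = D * (D' * A) := by rw [← mul_assoc, hDD, one_mul]
      rw [hfac]
      refine S.mul_mem hD (key _ ?_ ?_ ?_ ?_)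
      · rw [det_mul, hdet _ hD', hA, one_mul]
      · have hda : ∀ i, (if i = k then 1 + (w - 1) else if i = l then A k k else 1) - 1 ∈ a := by
          intro i
          split_ifs
          · simpa using hwa
          · simpa using ha k k
          · simp
        intro i j
        have := a.add_mem (a.mul_mem_right (A i j) (hda i)) (ha i j)
        rw [Matrix.sub_apply, hDd', diagonal_mul]
        rw [Matrix.sub_apply] at this
        convert this using 1
        ring
      · intro i j hij
        rw [hDd', diagonal_mul, hsup i j hij]
        by_cases h : i = j
        · subst h
          have hi : i ∉ insert k t := by tauto
          have : i ≠ k := by rintro rfl; simp at hi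
          have : i ≠ l := by rintro rfl; simp [hl] at hi
          simp [*]
        · simp [h]
      · rw [hDd', diagonal_mul]
        simp; linear_combination hw'

theorem unit_aux (k : Type*) [Field k] [NumberField k] (m : ℕ) (hm : 2 ≤ m)
    (x : paperSRing k m) : ∃ w : paperSRing k m, (1 + (m : paperSRing k m) * x) * w = 1 := by
  have hmem : ∀ y : k, y ∈ paperSRing k m ↔
      ∀ v : IsDedekindDomain.HeightOneSpectrum (NumberField.RingOfIntegers k),
        (m : NumberField.RingOfIntegers k) ∈ v.asIdeal → v.valuation k y ≤ 1 := by
    intro y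
    simp only [paperSRing, Subring.mem_iInf, Set.mem_ofPred_eq, Valuation.mem_integer_iff]
  have hval : ∀ v : IsDedekindDomain.HeightOneSpectrum (NumberField.RingOfIntegers k),
        (m : NumberField.RingOfIntegers k) ∈ v.asIdeal →
        v.valuation k (1 + (m : k) * x) = 1 := by
    intro v hv
    apply Valuation.map_one_add_of_lt
    rw [map_mul]
    have h1 := (v.valuation_lt_one_iff_mem (K := k) (m : NumberField.RingOfIntegers k)).2 hv
    have h2 := (hmem x).1 x.2 v hv
    have h3 : ((m : NumberField.RingOfIntegers k) : k) = (m : k) := by simp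
    have h1 : v.valuation k (m : k) < 1 := by rw [← h3]; exact h1
    exact mul_lt_one_of_lt_of_le h1 h2
  have hex : ∃ v : IsDedekindDomain.HeightOneSpectrum (NumberField.RingOfIntegers k),
        (m : NumberField.RingOfIntegers k) ∈ v.asIdeal := by
    have hnu : ¬ IsUnit (m : NumberField.RingOfIntegers k) := by
      intro h
      have h' := NumberField.isUnit_iff_norm.1 h
      have e : (RingOfIntegers.norm ℚ (m : NumberField.RingOfIntegers k) : ℚ) =
          (m : ℚ) ^ Module.finrank ℚ k := by
        rw [RingOfIntegers.coe_norm]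
        have := Algebra.norm_algebraMap (R := ℚ) (S := k) (m : ℚ)
        simpa using this
      rw [e, abs_of_nonneg (by positivity)] at h'
      have : (1 : ℚ) < (m : ℚ) ^ Module.finrank ℚ k :=
        one_lt_pow₀ (by exact_mod_cast hm) (Module.finrank_pos).ne'
      linarith
    obtain ⟨M, hM, hmM⟩ := exists_max_ideal_of_mem_nonunits hnu
    refine ⟨⟨M, hM.isPrime, ?_⟩, hmM⟩
    rintro rfl
    have : (m : NumberField.RingOfIntegers k) = 0 := by simpa using hmM
    have : m = 0 := by exact_mod_cast this
    omega
  obtain ⟨v0, hv0⟩ := hex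
  have hne : (1 + (m : k) * x) ≠ 0 := by
    intro h
    have := hval v0 hv0
    rw [h] at this
    simp at this
  refine ⟨⟨(1 + (m : k) * x)⁻¹, (hmem _).2 fun v hv => ?_⟩, ?_⟩
  · rw [map_inv₀, hval v hv, inv_one]
  · apply Subtype.ext
    push_cast
    exact mul_inv_cancel₀ hne

end CongAux

/-- Lemma `congruence` (§7.1) of the paper: every finite-index subgroup of
`SL_n(R)` is a congruence subgroup, i.e. contains all matrices congruent to the
identity modulo some nonzero ideal `𝔞` of `R`. -/
theorem paper_finite_index_subgroups_are_congruence
    (k : Type*) [Field k] [NumberField k] (m : ℕ) (hm : 2 ≤ m) (n : ℕ) (hn : 2 ≤ n)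
    (H : Subgroup (Matrix.SpecialLinearGroup (Fin n) (paperSRing k m)))
    (hfin : H.FiniteIndex) :
    ∃ 𝔞 : Ideal (paperSRing k m), 𝔞 ≠ ⊥ ∧
      ∀ A : Matrix.SpecialLinearGroup (Fin n) (paperSRing k m),
        (∀ i j : Fin n,
          ((A : Matrix (Fin n) (Fin n) (paperSRing k m)) - 1) i j ∈ 𝔞) → A ∈ H := by
  classical
  set N := H.normalCore with hN
  have hNfin : N.FiniteIndex := inferInstance
  set e := N.index with he
  have he0 : e ≠ 0 := hNfin.index_ne_zero
  let S : Submonoid (Matrix (Fin n) (Fin n) (paperSRing k m)) :=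
    { carrier := {M | ∃ g ∈ N, (g : Matrix (Fin n) (Fin n) (paperSRing k m)) = M}
      one_mem' := ⟨1, N.one_mem, rfl⟩
      mul_mem' := by
        rintro _ _ ⟨g, hg, rfl⟩ ⟨h, hh, rfl⟩
        exact ⟨g * h, N.mul_mem hg hh, rfl⟩ }
  have hpow : ∀ (i j : Fin n) (hij : i ≠ j) (x : paperSRing k m) (r : ℕ),
      ((Matrix.SpecialLinearGroup.transvection hij x) ^ r) =
        Matrix.SpecialLinearGroup.transvection hij (r * x) := by
    intro i j hij x r
    apply Subtype.ext
    induction r with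
    | zero =>
      rw [pow_zero]
      simp [Matrix.SpecialLinearGroup.transvection]
    | succ r ih =>
      rw [pow_succ, Matrix.SpecialLinearGroup.coe_mul, ih]
      simp only [Matrix.SpecialLinearGroup.transvection]
      rw [Matrix.transvection_mul_transvection_same _ _ hij]
      congr 1
      push_cast
      ring
  have hmem : ∀ (i j : Fin n) (hij : i ≠ j) (x : paperSRing k m),
      x ∈ Ideal.span {((m * e : ℕ) : paperSRing k m)} →
      Matrix.SpecialLinearGroup.transvection hij x ∈ N := by
    intro i j hij x hx
    obtain ⟨y, rfl⟩ := Ideal.mem_span_singleton'.1 hx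
    have := N.pow_index_mem (Matrix.SpecialLinearGroup.transvection hij (y * m))
    rw [hpow] at this
    convert this using 2
    push_cast
    ring
  refine ⟨Ideal.span {((m * e : ℕ) : paperSRing k m)}, ?_, ?_⟩
  · rw [Ne, Ideal.span_singleton_eq_bot]
    have : m * e ≠ 0 := mul_ne_zero (by omega) he0
    intro h
    apply this
    have h2 := congrArg (Subtype.val) h
    push_cast at h2
    exact_mod_cast h2
  · intro A hA
    have : (A : Matrix (Fin n) (Fin n) (paperSRing k m)) ∈ S := by
      refine CongAux.main S (Ideal.span {((m * e : ℕ) : paperSRing k m)}) ?_ ?_ ?_ ?_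
        Finset.univ _ A.2 hA (by simp)
      · intro i j hij x hx
        exact ⟨_, hmem i j hij x hx, rfl⟩
      · intro i j hij x hx
        refine ⟨Matrix.SpecialLinearGroup.transvection hij 1 *
          Matrix.SpecialLinearGroup.transvection hij.symm x *
          (Matrix.SpecialLinearGroup.transvection hij 1)⁻¹,
          (H.normalCore_normal).conj_mem _ (hmem j i hij.symm x hx) _, ?_⟩
        have : (Matrix.SpecialLinearGroup.transvection hij (1 : paperSRing k m))⁻¹ =
            Matrix.SpecialLinearGroup.transvection hij (-1) := by
          rw [inv_eq_iff_mul_eq_one]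
          apply Subtype.ext
          rw [Matrix.SpecialLinearGroup.coe_mul]
          simp only [Matrix.SpecialLinearGroup.transvection]
          rw [Matrix.transvection_mul_transvection_same _ _ hij]
          simp
        rw [this]
        rfl
      · rintro _ ⟨g, _, rfl⟩
        exact g.2
      · intro x hx
        obtain ⟨y, rfl⟩ := Ideal.mem_span_singleton'.1 hx
        obtain ⟨w, hw⟩ := CongAux.unit_aux k m hm (y * e)
        refine ⟨w, ?_⟩
        push_cast
        linear_combination hw
    obtain ⟨g, hg, hgA⟩ := this
    have : g = A := Subtype.ext hgA
    rw [← this]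
    exact H.normalCore_le hg
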